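/- arXiv:1507.04938 — 5 statements merged into one kernel-verified Lean document; each statement's English description precedes it below -/
import Mathlib

section
/- The Gray map Φ : R^n → (Z₂)^{4n} is distance preserving from (R^n, Lee distance) to (Z₂^{4n}, Hamming distance): for all c₁, c₂ ∈ R^n, d_L(c₁, c₂) = d_H(Φ(c₁), Φ(c₂)). -/
open TrivSqZeroExt

/-- The ring `R = ℤ₄ + uℤ₄ = ℤ₄[u]/⟨u²⟩`, modelled as dual numbers over `ℤ₄`. -/
abbrev R4 : Type := DualNumber (ZMod 4)

/-- `β : ℤ₄ → ℤ₂`, with `β(0)=0, β(1)=0, β(2)=1, β(3)=1`. -/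
def grayBeta (c : ZMod 4) : ZMod 2 := if c = 2 ∨ c = 3 then 1 else 0

/-- `γ : ℤ₄ → ℤ₂`, with `γ(0)=0, γ(1)=1, γ(2)=1, γ(3)=0`. -/
def grayGamma (c : ZMod 4) : ZMod 2 := if c = 1 ∨ c = 2 then 1 else 0

/-- The Gray map `Φ : R^n → ℤ₂^{4n}`. -/
def grayPhi {n : ℕ} (c : Fin n → R4) : Fin (4 * n) → ZMod 2 := fun j =>
  let i : Fin n := ⟨j.val / 4, by have h := j.isLt; omega⟩
  let a : ZMod 4 := (c i).fst
  let b : ZMod 4 := (c i).snd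
  match j.val % 4 with
  | 0 => grayBeta b
  | 1 => grayGamma b
  | 2 => grayBeta (a + b)
  | _ => grayGamma (a + b)

/-- The Lee weight on `ℤ₄`: `w_L(c) = min{c, 4 - c}`. -/
def leeWt4 (c : ZMod 4) : ℕ := min c.val (4 - c.val)

/-- The Lee weight on `R`: `w_L(a + ub) = w_L(b) + w_L(a + b)`. -/
def leeWtR (x : R4) : ℕ := leeWt4 x.snd + leeWt4 (x.fst + x.snd)

/-- The Lee distance on `R^n`: `d_L(c₁, c₂) = w_L(c₁ - c₂)` (coordinatewise sum). -/
def leeDist {n : ℕ} (c₁ c₂ : Fin n → R4) : ℕ := ∑ i, leeWtR (c₁ i - c₂ i)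

/-- The Hamming distance on `ℤ₂^m`. -/
def hamDist {m : ℕ} (v w : Fin m → ZMod 2) : ℕ :=
  (Finset.univ.filter fun j => v j ≠ w j).card

/-- The Gray map `(β, γ)` is an isometry from `ℤ₄` with the Lee distance. -/
theorem leeWt4_sub (x y : ZMod 4) :
    leeWt4 (x - y) = (if grayBeta x ≠ grayBeta y then 1 else 0) +
      (if grayGamma x ≠ grayGamma y then 1 else 0) := by
  revert x y
  decide

/-- The position `4 * i + k` in `ℤ₂^{4n}` of the `k`-th bit of the `i`-th coordinate. -/
def grayIndex (n : ℕ) : Fin n × Fin 4 ≃ Fin (4 * n) :=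
  finProdFinEquiv.trans (finCongr (mul_comm n 4))

theorem grayPhi_grayIndex {n : ℕ} (c : Fin n → R4) (i : Fin n) (k : Fin 4) :
    grayPhi c (grayIndex n (i, k)) =
      ![grayBeta (c i).snd, grayGamma (c i).snd, grayBeta ((c i).fst + (c i).snd),
        grayGamma ((c i).fst + (c i).snd)] k := by
  have hval : (grayIndex n (i, k)).val = k.val + 4 * i.val := rfl
  have hdiv : (grayIndex n (i, k)).val / 4 = i.val := by omega
  have hmod : (grayIndex n (i, k)).val % 4 = k.val := by omega
  simp only [grayPhi, hdiv, hmod]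
  fin_cases k <;> rfl

/-- The Gray map `Φ` is distance preserving from `(R^n, Lee distance)` to
`(ℤ₂^{4n}, Hamming distance)`. -/
theorem grayPhi_distance_preserving (n : ℕ) (c₁ c₂ : Fin n → R4) :
    leeDist c₁ c₂ = hamDist (grayPhi c₁) (grayPhi c₂) := by
  unfold leeDist hamDist
  rw [Finset.card_filter, ← (grayIndex n).sum_comp, Fintype.sum_prod_type]
  refine Finset.sum_congr rfl fun i _ => ?_
  have hadd : (c₁ i - c₂ i).fst + (c₁ i - c₂ i).snd =
      ((c₁ i).fst + (c₁ i).snd) - ((c₂ i).fst + (c₂ i).snd) := by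
    rw [fst_sub, snd_sub]
    ring
  rw [leeWtR, hadd, snd_sub, leeWt4_sub, leeWt4_sub]
  simp only [grayPhi_grayIndex, Fin.sum_univ_four]
  exact (add_assoc _ _ _).symm
end

section
/- A linear code C of length n over R (an R-submodule of R^n) is a cyclic code (invariant under the cyclic shift σ) if and only if its Gray image Φ(C) ⊆ Z₂^{4n} is a 4-quasi-cyclic code of length 4n over Z₂, i.e., Φ(C) is invariant under the 4-quasi-cyclic shift ν. -/
open TrivSqZeroExt

/-- The cyclic shift `σ` on `αⁿ`: `σ(c₀, …, c_{n-1}) = (c_{n-1}, c₀, …, c_{n-2})`. -/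
def cyclicShift {α : Type*} {n : ℕ} (c : Fin n → α) : Fin n → α :=
  fun i => c ⟨(i.val + (n - 1)) % n, Nat.mod_lt _ i.pos⟩

/-- The 4-quasi-cyclic shift `ν` on `ℤ₂^{4n}`, moving the last four coordinates
to the front. -/
def qcShift4 {n : ℕ} (v : Fin (4 * n) → ZMod 2) : Fin (4 * n) → ZMod 2 :=
  fun j => v ⟨(j.val + (4 * n - 4)) % (4 * n), Nat.mod_lt _ j.pos⟩

theorem grayBeta_grayGamma_injective {x y : ZMod 4} (hb : grayBeta x = grayBeta y)
    (hg : grayGamma x = grayGamma y) : x = y := by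
  revert x y
  decide

theorem grayPhi_injective {n : ℕ} : Function.Injective (grayPhi (n := n)) := by
  intro c d h
  funext i
  have coord (k : ℕ) (hk : k < 4) := congrFun h ⟨4 * i.val + k, by have := i.isLt; omega⟩
  have hdiv (k : ℕ) (hk : k < 4) : (4 * i.val + k) / 4 = i.val := by omega
  have hmod (k : ℕ) (hk : k < 4) : (4 * i.val + k) % 4 = k := by omega
  have h0 := coord 0 (by norm_num)
  have h1 := coord 1 (by norm_num)
  have h2 := coord 2 (by norm_num)
  have h3 := coord 3 (by norm_num)
  simp only [grayPhi, hdiv 0 (by norm_num), hmod 0 (by norm_num)] at h0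
  simp only [grayPhi, hdiv 1 (by norm_num), hmod 1 (by norm_num)] at h1
  simp only [grayPhi, hdiv 2 (by norm_num), hmod 2 (by norm_num)] at h2
  simp only [grayPhi, hdiv 3 (by norm_num), hmod 3 (by norm_num)] at h3
  have hsnd := grayBeta_grayGamma_injective h0 h1
  have hsum := grayBeta_grayGamma_injective h2 h3
  rw [hsnd] at hsum
  exact TrivSqZeroExt.ext (add_right_cancel hsum) hsnd

/-- The Gray map intertwines the cyclic shift and the 4-quasi-cyclic shift. -/
theorem qcShift4_grayPhi {n : ℕ} (c : Fin n → R4) :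
    qcShift4 (grayPhi c) = grayPhi (cyclicShift c) := by
  funext j
  have hn : 0 < n := by have := j.isLt; omega
  have hmod : (j.val + (4 * n - 4)) % (4 * n) % 4 = j.val % 4 := by
    rw [Nat.mod_mul_right_mod]
    omega
  have hdiv : (j.val + (4 * n - 4)) % (4 * n) / 4 = (j.val / 4 + (n - 1)) % n := by
    rw [Nat.mod_mul_right_div_self]
    congr 1
    omega
  simp only [qcShift4, grayPhi, cyclicShift, hmod, hdiv]

/-- A linear code `C ⊆ R^n` (an `R`-submodule of `R^n`) is cyclic (invariant under
the cyclic shift `σ`) if and only if its Gray image `Φ(C)` is invariant under the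
4-quasi-cyclic shift `ν` on `ℤ₂^{4n}`, i.e. `Φ(C)` is a 4-quasi-cyclic code of
length `4n` over `ℤ₂`. -/
theorem cyclic_iff_gray_image_qc (n : ℕ) (C : Submodule R4 (Fin n → R4)) :
    cyclicShift '' (C : Set (Fin n → R4)) = (C : Set (Fin n → R4)) ↔
      qcShift4 '' (grayPhi '' (C : Set (Fin n → R4)))
        = grayPhi '' (C : Set (Fin n → R4)) := by
  have image_comm : qcShift4 '' (grayPhi '' (C : Set (Fin n → R4))) =
      grayPhi '' (cyclicShift '' (C : Set (Fin n → R4))) := by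
    simp only [Set.image_image, qcShift4_grayPhi]
  rw [image_comm, grayPhi_injective.image_injective.eq_iff]
end

section
/- For every positive integer n, the quotient ring R_n = R[x]/⟨xⁿ − 1⟩ is not a principal ideal ring: there exists an ideal of R_n that is not generated by a single element. -/
open Polynomial

set_option synthInstance.maxHeartbeats 1000000

/-- Shortcut instances (definitionally `inferInstance`) to speed up elaboration. -/
noncomputable instance instCommRingPolyR4 : CommRing (Polynomial R4) := inferInstance

noncomputable instance instCommRingRn (n : ℕ) :
    CommRing (Polynomial R4 ⧸ Ideal.span {(X ^ n - 1 : Polynomial R4)}) := inferInstance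

/-- In `ℤ₄ + uℤ₄` the maximal ideal `⟨2, u⟩` is not principal. -/
theorem R4_span_two_eps_not_isPrincipal :
    ¬ (Ideal.span {(2 : R4), (DualNumber.eps : R4)}).IsPrincipal := by
  rintro ⟨g, hg⟩
  rw [Ideal.submodule_span_eq] at hg
  have hmem : g ∈ Ideal.span {(2 : R4), (DualNumber.eps : R4)} :=
    hg ▸ Ideal.mem_span_singleton_self g
  have htwo : (2 : R4) ∈ Ideal.span {g} := hg ▸ Ideal.subset_span (by simp)
  have heps : (DualNumber.eps : R4) ∈ Ideal.span {g} := hg ▸ Ideal.subset_span (by simp)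
  obtain ⟨p, q, hpq⟩ := Ideal.mem_span_pair.1 hmem
  obtain ⟨c, hc⟩ := Ideal.mem_span_singleton'.1 htwo
  obtain ⟨e, he⟩ := Ideal.mem_span_singleton'.1 heps
  have fst_two : TrivSqZeroExt.fst (2 : R4) = 2 := rfl
  have hp := congrArg TrivSqZeroExt.fst hpq
  have hc₁ := congrArg TrivSqZeroExt.fst hc
  have he₁ := congrArg TrivSqZeroExt.fst he
  have he₂ := congrArg TrivSqZeroExt.snd he
  simp [fst_two] at hp hc₁ he₁ he₂
  have key : ∀ p c e g f h : ZMod 4, p * 2 = g → c * g = 2 → e * g = 0 →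
      e * h + f * g = 1 → False := by decide
  exact key _ _ _ _ _ _ hp hc₁ he₁ he₂

/-- For every positive integer `n`, the quotient ring `R_n = R[x]/⟨xⁿ − 1⟩` is not a
principal ideal ring: it has an ideal that is not generated by a single element. -/
theorem Rn_not_principal_ideal_ring (n : ℕ) (hn : 0 < n) :
    ∃ I : Ideal (Polynomial R4 ⧸ Ideal.span {(X ^ n - 1 : Polynomial R4)}),
      ¬ Submodule.IsPrincipal I := by
  let φ : (Polynomial R4 ⧸ Ideal.span {(X ^ n - 1 : Polynomial R4)}) →+* R4 :=
    Ideal.Quotient.lift _ (evalRingHom 1) fun a ha => by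
      obtain ⟨b, rfl⟩ := Ideal.mem_span_singleton'.1 ha
      simp
  have hφ : Function.Surjective φ := fun r =>
    ⟨Ideal.Quotient.mk _ (C r), by simp [φ]⟩
  refine ⟨(Ideal.span {(2 : R4), (DualNumber.eps : R4)}).comap φ, fun ⟨g, hg⟩ =>
    R4_span_two_eps_not_isPrincipal ⟨φ g, ?_⟩⟩
  rw [← Ideal.map_comap_of_surjective φ hφ (Ideal.span _), hg, Ideal.submodule_span_eq,
    Ideal.map_span, Set.image_singleton, Ideal.submodule_span_eq]
end

section
/- The ring R = Z₄ + uZ₄ has exactly 7 ideals, namely the set of ideals of R is exactly { {0}, ⟨2u⟩, ⟨u⟩, ⟨2⟩, ⟨2+u⟩, ⟨2,u⟩, R }. -/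
local notation "u" => (DualNumber.eps : R4)

namespace R4

instance : DecidableEq R4 := inferInstanceAs (DecidableEq (ZMod 4 × ZMod 4))

instance : Fintype R4 := inferInstanceAs (Fintype (ZMod 4 × ZMod 4))

theorem mem_span_two_mul_eps (x : R4) :
    x ∈ Ideal.span {2 * u} ↔ x.fst = 0 ∧ 2 * x.snd = 0 := by
  rw [Ideal.mem_span_singleton']
  revert x
  decide

theorem mem_span_eps (x : R4) : x ∈ Ideal.span {u} ↔ x.fst = 0 := by
  rw [Ideal.mem_span_singleton']
  revert x
  decide

theorem mem_span_two (x : R4) :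
    x ∈ Ideal.span {(2 : R4)} ↔ 2 * x.fst = 0 ∧ 2 * x.snd = 0 := by
  rw [Ideal.mem_span_singleton']
  revert x
  decide

theorem mem_span_two_add_eps (x : R4) :
    x ∈ Ideal.span {2 + u} ↔ x.fst = 2 * x.snd := by
  rw [Ideal.mem_span_singleton']
  revert x
  decide

theorem mem_span_two_eps (x : R4) :
    x ∈ Ideal.span {(2 : R4), u} ↔ 2 * x.fst = 0 := by
  rw [Ideal.mem_span_pair]
  constructor
  · rintro ⟨a, b, rfl⟩
    revert a b
    decide
  · intro h
    have key : ∀ x : R4, 2 * x.fst = 0 → ∃ a, a * 2 + TrivSqZeroExt.inl x.snd * u = x := by decide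
    obtain ⟨a, ha⟩ := key x h
    exact ⟨a, _, ha⟩

/-- Every element of `R4` is associated to one of `0`, `2u`, `u`, `2`, `2 + u`, `1`. -/
theorem exists_associated (x : R4) :
    ∃ g ∈ ({0, 2 * u, u, 2, 2 + u, 1} : Finset R4), (∃ y, y * g = x) ∧ ∃ z, z * x = g := by
  revert x
  decide

theorem ideal_le_of_mem {I J : Ideal R4} (h₁ : 2 * u ∈ I → 2 * u ∈ J) (h₂ : u ∈ I → u ∈ J)
    (h₃ : (2 : R4) ∈ I → (2 : R4) ∈ J) (h₄ : 2 + u ∈ I → 2 + u ∈ J)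
    (h₅ : (1 : R4) ∈ I → (1 : R4) ∈ J) : I ≤ J := by
  intro x hx
  obtain ⟨g, hg, ⟨y, rfl⟩, z, hz⟩ := exists_associated x
  have hgI : g ∈ I := hz ▸ I.mul_mem_left z hx
  refine J.mul_mem_left y ?_
  simp only [Finset.mem_insert, Finset.mem_singleton] at hg
  rcases hg with rfl | rfl | rfl | rfl | rfl | rfl
  exacts [J.zero_mem, h₁ hgI, h₂ hgI, h₃ hgI, h₄ hgI, h₅ hgI]

/-- An ideal of `R4` is determined by which of `2u`, `u`, `2`, `2 + u`, `1` it contains. -/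
theorem ideal_ext {I J : Ideal R4} (h₁ : 2 * u ∈ I ↔ 2 * u ∈ J) (h₂ : u ∈ I ↔ u ∈ J)
    (h₃ : (2 : R4) ∈ I ↔ (2 : R4) ∈ J) (h₄ : 2 + u ∈ I ↔ 2 + u ∈ J)
    (h₅ : (1 : R4) ∈ I ↔ (1 : R4) ∈ J) : I = J :=
  le_antisymm (ideal_le_of_mem h₁.1 h₂.1 h₃.1 h₄.1 h₅.1)
    (ideal_le_of_mem h₁.2 h₂.2 h₃.2 h₄.2 h₅.2)

theorem ideal_classification (I : Ideal R4) :
    I = ⊥ ∨ I = Ideal.span {2 * u} ∨ I = Ideal.span {u} ∨ I = Ideal.span {(2 : R4)} ∨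
      I = Ideal.span {2 + u} ∨ I = Ideal.span {(2 : R4), u} ∨ I = ⊤ := by
  have of_eps : u ∈ I → 2 * u ∈ I := I.mul_mem_left 2
  have of_two : (2 : R4) ∈ I → 2 * u ∈ I := I.mul_mem_right u
  have of_add : 2 + u ∈ I → 2 * u ∈ I := fun h => by
    have e : (2 : R4) * (2 + u) = 2 * u := by decide
    exact e ▸ I.mul_mem_left 2 h
  have of_add_two : 2 + u ∈ I → (2 : R4) ∈ I → u ∈ I := fun h h₂ => (I.add_mem_iff_right h₂).1 h
  have of_add_eps : 2 + u ∈ I → u ∈ I → (2 : R4) ∈ I := fun h hu => (I.add_mem_iff_left hu).1 h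
  by_cases h₁ : (1 : R4) ∈ I
  · have h := (Ideal.eq_top_iff_one I).2 h₁
    exact .inr (.inr (.inr (.inr (.inr (.inr h)))))
  by_cases hu : u ∈ I
  · have h₂u := of_eps hu
    by_cases h₂ : (2 : R4) ∈ I
    · have h : I = Ideal.span {(2 : R4), u} := by
        apply ideal_ext <;> simp only [mem_span_two_eps, I.add_mem h₂ hu, *] <;> decide
      exact .inr (.inr (.inr (.inr (.inr (.inl h)))))
    · have h₃ : 2 + u ∉ I := fun h => h₂ (of_add_eps h hu)
      have h : I = Ideal.span {u} := by
        apply ideal_ext <;> simp only [mem_span_eps, *] <;> decide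
      exact .inr (.inr (.inl h))
  by_cases h₂ : (2 : R4) ∈ I
  · have h₂u := of_two h₂
    have h₃ : 2 + u ∉ I := fun h => hu (of_add_two h h₂)
    have h : I = Ideal.span {(2 : R4)} := by
      apply ideal_ext <;> simp only [mem_span_two, *] <;> decide
    exact .inr (.inr (.inr (.inl h)))
  by_cases h₃ : 2 + u ∈ I
  · have h₂u := of_add h₃
    have h : I = Ideal.span {2 + u} := by
      apply ideal_ext <;> simp only [mem_span_two_add_eps, *] <;> decide
    exact .inr (.inr (.inr (.inr (.inl h))))
  by_cases h₂u : 2 * u ∈ I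
  · have h : I = Ideal.span {2 * u} := by
      apply ideal_ext <;> simp only [mem_span_two_mul_eps, *] <;> decide
    exact .inr (.inl h)
  · have h : I = ⊥ := by
      apply ideal_ext <;> simp only [Ideal.mem_bot, *] <;> decide
    exact .inl h

end R4

/-- The set of ideals of `R = ℤ₄ + uℤ₄` is exactly
`{ {0}, ⟨2u⟩, ⟨u⟩, ⟨2⟩, ⟨2+u⟩, ⟨2,u⟩, R }`, so `R` has exactly `7` ideals. -/
theorem R4_ideals :
    (Set.univ : Set (Ideal R4)) =
      {⊥, Ideal.span {2 * u}, Ideal.span {u}, Ideal.span {(2 : R4)},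
        Ideal.span {2 + u}, Ideal.span {(2 : R4), u}, ⊤} ∧
    Nat.card (Ideal R4) = 7 := by
  have huniv : (Set.univ : Set (Ideal R4)) =
      {⊥, Ideal.span {2 * u}, Ideal.span {u}, Ideal.span {(2 : R4)},
        Ideal.span {2 + u}, Ideal.span {(2 : R4), u}, ⊤} :=
    (Set.eq_univ_of_forall R4.ideal_classification).symm
  refine ⟨huniv, ?_⟩
  rw [← Set.ncard_univ, huniv]
  repeat rw [Set.ncard_insert_of_notMem]
  · rw [Set.ncard_singleton]
  all_goals
    simp only [Set.mem_insert_iff, Set.mem_singleton_iff, SetLike.ext_iff, Submodule.mem_top,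
      Ideal.mem_bot, R4.mem_span_two_mul_eps, R4.mem_span_eps, R4.mem_span_two,
      R4.mem_span_two_add_eps, R4.mem_span_two_eps]
    decide
end

section
/- Let C₁ and C₂ be linear codes of length n over Z₄ (Z₄-submodules of Z₄ⁿ) and let C = C₁ + uC₂ = { a + u·b : a ∈ C₁, b ∈ C₂ } ⊆ Rⁿ, where a + u·b denotes the vector with i-th coordinate aᵢ + u bᵢ. Then C is invariant under the cyclic shift σ on Rⁿ if and only if C₁ and C₂ are cyclic codes of length n over Z₄, i.e., both are invariant under the cyclic shift on Z₄ⁿ. -/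
open TrivSqZeroExt

/-- The code `C = C₁ + u·C₂ = { a + u·b : a ∈ C₁, b ∈ C₂ } ⊆ Rⁿ`. -/
def plusUCode {n : ℕ} (C₁ C₂ : Submodule (ZMod 4) (Fin n → ZMod 4)) :
    Set (Fin n → R4) :=
  {v | ∃ a ∈ C₁, ∃ b ∈ C₂,
    v = fun i => inl (a i) + DualNumber.eps * inl (b i)}

/-- The cyclic shift only permutes coordinates, so it commutes with coordinatewise maps. -/
theorem cyclicShift_comp {α β : Type*} {n : ℕ} (f : α → β) (c : Fin n → α) :
    cyclicShift (f ∘ c) = f ∘ cyclicShift c :=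
  rfl

theorem plusUCode_eq_image2 {n : ℕ} (C₁ C₂ : Submodule (ZMod 4) (Fin n → ZMod 4)) :
    plusUCode C₁ C₂ =
      Set.image2 (fun (a b : Fin n → ZMod 4) i => (inl (a i) + DualNumber.eps * inl (b i) : R4)) C₁ C₂ := by
  ext v
  simp [plusUCode, Set.mem_image2, eq_comm]

theorem image_fst_plusUCode {n : ℕ} (C₁ C₂ : Submodule (ZMod 4) (Fin n → ZMod 4)) :
    (fun v : Fin n → R4 => fst ∘ v) '' plusUCode C₁ C₂ = C₁ := by
  rw [plusUCode_eq_image2, Set.image_image2]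
  convert Set.image2_left (s := (C₁ : Set (Fin n → ZMod 4))) ⟨0, C₂.zero_mem⟩ using 2
  ext
  simp

theorem image_snd_plusUCode {n : ℕ} (C₁ C₂ : Submodule (ZMod 4) (Fin n → ZMod 4)) :
    (fun v : Fin n → R4 => snd ∘ v) '' plusUCode C₁ C₂ = C₂ := by
  rw [plusUCode_eq_image2, Set.image_image2]
  convert Set.image2_right (t := (C₂ : Set (Fin n → ZMod 4))) ⟨0, C₁.zero_mem⟩ using 2
  ext
  simp

/-- `C = C₁ + uC₂` is invariant under the cyclic shift on `Rⁿ` if and only if `C₁`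
and `C₂` are cyclic codes of length `n` over `ℤ₄`, i.e. both are invariant under
the cyclic shift on `ℤ₄ⁿ`. -/
theorem plusUCode_cyclic_iff (n : ℕ) (C₁ C₂ : Submodule (ZMod 4) (Fin n → ZMod 4)) :
    cyclicShift '' plusUCode C₁ C₂ = plusUCode C₁ C₂ ↔
      (cyclicShift '' (C₁ : Set (Fin n → ZMod 4)) = (C₁ : Set (Fin n → ZMod 4)) ∧
       cyclicShift '' (C₂ : Set (Fin n → ZMod 4)) = (C₂ : Set (Fin n → ZMod 4))) := by
  constructor
  · intro h
    constructor
    · rw [← image_fst_plusUCode C₁ C₂,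
        Set.image_comm (f := cyclicShift) (g := fun v : Fin n → R4 => fst ∘ v)
          fun v => cyclicShift_comp fst v, h]
    · rw [← image_snd_plusUCode C₁ C₂,
        Set.image_comm (f := cyclicShift) (g := fun v : Fin n → R4 => snd ∘ v)
          fun v => cyclicShift_comp snd v, h]
  · rintro ⟨h₁, h₂⟩
    rw [plusUCode_eq_image2,
      Set.image_image2_distrib (g₁ := cyclicShift) (g₂ := cyclicShift)
        (f' := fun (a b : Fin n → ZMod 4) i => (inl (a i) + DualNumber.eps * inl (b i) : R4))
        fun _ _ => rfl, h₁, h₂]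
end
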